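/- arXiv:1611.06714 — 11 statements merged into one kernel-verified Lean document; each statement's English description precedes it below -/
import Mathlib

section
/- Let c₁, c₂ : ℝ × ℝ → ℝ be measurable functions, strictly positive on [0,1]², each integrating to 1 with respect to Lebesgue measure on [0,1]² (i.e., two probability densities on the unit square). Assume: (i) the function (u,v) ↦ log c₁(u,v) is supermodular on [0,1]²; (ii) for every measurable supermodular function f : ℝ × ℝ → ℝ such that f·c₁ and f·c₂ are both Lebesgue-integrable on [0,1]², one has ∫_{[0,1]²} f·c₁ ≤ ∫_{[0,1]²} f·c₂; (iii) the functions c₁·log c₁, c₂·log c₁, and c₂·log c₂ are all Lebesgue-integrable on [0,1]². Then ∫_{[0,1]²} c₁ · log c₁ ≤ ∫_{[0,1]²} c₂ · log c₂; that is, the negative entropy of the density c₁ is at most the negative entropy of the density c₂. -/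
open MeasureTheory

/-- **Gibbs' inequality**: the entropy of a positive density is at most its cross-entropy with
respect to another positive density of the same mass. -/
theorem integral_mul_log_le_integral_mul_log_self {α : Type*} [MeasurableSpace α]
    {μ : Measure α} {s : Set α} (hs : MeasurableSet s) {f g : α → ℝ}
    (hf : ∀ x ∈ s, 0 < f x) (hg : ∀ x ∈ s, 0 < g x)
    (hfi : IntegrableOn f s μ) (hgi : IntegrableOn g s μ)
    (hfg : ∫ x in s, f x ∂μ = ∫ x in s, g x ∂μ)
    (hcross : IntegrableOn (fun x => g x * Real.log (f x)) s μ)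
    (hself : IntegrableOn (fun x => g x * Real.log (g x)) s μ) :
    ∫ x in s, g x * Real.log (f x) ∂μ ≤ ∫ x in s, g x * Real.log (g x) ∂μ := by
  have key : ∫ x in s, (g x * Real.log (f x) - g x * Real.log (g x)) ∂μ ≤
      ∫ x in s, (f x - g x) ∂μ := by
    refine setIntegral_mono_on (hcross.sub hself) (hfi.sub hgi) hs fun x hx => ?_
    have hlog := Real.log_le_sub_one_of_pos (div_pos (hf x hx) (hg x hx))
    rw [Real.log_div (hf x hx).ne' (hg x hx).ne'] at hlog
    calc g x * Real.log (f x) - g x * Real.log (g x)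
        = g x * (Real.log (f x) - Real.log (g x)) := by ring
      _ ≤ g x * (f x / g x - 1) := mul_le_mul_of_nonneg_left hlog (hg x hx).le
      _ = f x - g x := by
        have := (hg x hx).ne'
        field_simp
  rw [integral_sub hcross hself, integral_sub hfi hgi, hfg] at key
  linarith

/-- If `c₁, c₂` are probability densities on the unit square `[0,1]²`, `log c₁` is
supermodular on `[0,1]²`, and the density `c₂` dominates `c₁` in the supermodular
stochastic order, then the negative entropy of `c₁` is at most that of `c₂`. -/
theorem negentropy_le_of_supermodular_order (c₁ c₂ : ℝ × ℝ → ℝ)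
    (hm₁ : Measurable c₁) (hm₂ : Measurable c₂)
    (hpos₁ : ∀ p ∈ Set.Icc ((0 : ℝ), (0 : ℝ)) (1, 1), 0 < c₁ p)
    (hpos₂ : ∀ p ∈ Set.Icc ((0 : ℝ), (0 : ℝ)) (1, 1), 0 < c₂ p)
    (hint₁ : (∫ p in Set.Icc ((0 : ℝ), (0 : ℝ)) (1, 1), c₁ p) = 1)
    (hint₂ : (∫ p in Set.Icc ((0 : ℝ), (0 : ℝ)) (1, 1), c₂ p) = 1)
    -- (i) `log c₁` is supermodular on `[0,1]²`
    (hsm : ∀ p ∈ Set.Icc ((0 : ℝ), (0 : ℝ)) (1, 1),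
      ∀ q ∈ Set.Icc ((0 : ℝ), (0 : ℝ)) (1, 1),
        Real.log (c₁ p) + Real.log (c₁ q) ≤
          Real.log (c₁ (p ⊔ q)) + Real.log (c₁ (p ⊓ q)))
    -- (ii) supermodular stochastic order
    (horder : ∀ f : ℝ × ℝ → ℝ, Measurable f →
      (∀ p q : ℝ × ℝ, f p + f q ≤ f (p ⊔ q) + f (p ⊓ q)) →
      IntegrableOn (fun p => f p * c₁ p) (Set.Icc ((0 : ℝ), (0 : ℝ)) (1, 1)) →
      IntegrableOn (fun p => f p * c₂ p) (Set.Icc ((0 : ℝ), (0 : ℝ)) (1, 1)) →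
      (∫ p in Set.Icc ((0 : ℝ), (0 : ℝ)) (1, 1), f p * c₁ p) ≤
        ∫ p in Set.Icc ((0 : ℝ), (0 : ℝ)) (1, 1), f p * c₂ p)
    -- (iii) integrability
    (hi₁ : IntegrableOn (fun p => c₁ p * Real.log (c₁ p))
      (Set.Icc ((0 : ℝ), (0 : ℝ)) (1, 1)))
    (hi₂ : IntegrableOn (fun p => c₂ p * Real.log (c₁ p))
      (Set.Icc ((0 : ℝ), (0 : ℝ)) (1, 1)))
    (hi₃ : IntegrableOn (fun p => c₂ p * Real.log (c₂ p))
      (Set.Icc ((0 : ℝ), (0 : ℝ)) (1, 1))) :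
    (∫ p in Set.Icc ((0 : ℝ), (0 : ℝ)) (1, 1), c₁ p * Real.log (c₁ p)) ≤
      ∫ p in Set.Icc ((0 : ℝ), (0 : ℝ)) (1, 1), c₂ p * Real.log (c₂ p) := by
  set s : Set (ℝ × ℝ) := Set.Icc (0, 0) (1, 1)
  have hs : MeasurableSet s := measurableSet_Icc
  -- The coordinatewise clamp onto the square is a lattice homomorphism fixing the square.
  let clamp : ℝ × ℝ → ℝ × ℝ := fun p => (p ⊔ (0, 0)) ⊓ (1, 1)
  have hclamp_mem : ∀ p, clamp p ∈ s := fun p =>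
    ⟨le_inf le_sup_right (by simp [Prod.le_def]), inf_le_right⟩
  have hclamp_eq : ∀ p ∈ s, clamp p = p := fun p hp => by
    simp only [clamp]
    rw [sup_eq_left.mpr hp.1, inf_eq_left.mpr hp.2]
  have hclamp_sup : ∀ p q, clamp (p ⊔ q) = clamp p ⊔ clamp q := fun p q => by
    simp only [clamp]
    rw [sup_sup_distrib_right, inf_sup_right]
  have hclamp_inf : ∀ p q, clamp (p ⊓ q) = clamp p ⊓ clamp q := fun p q => by
    simp only [clamp]
    rw [sup_inf_right, inf_inf_distrib_right]
  have hclamp_meas : Measurable clamp :=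
    ((measurable_fst.sup_const 0).inf_const 1).prodMk ((measurable_snd.sup_const 0).inf_const 1)
  let f : ℝ × ℝ → ℝ := fun p => Real.log (c₁ (clamp p))
  have hf_mul : ∀ c : ℝ × ℝ → ℝ,
      Set.EqOn (fun p => f p * c p) (fun p => c p * Real.log (c₁ p)) s := fun c p hp => by
    simp only [f]
    rw [hclamp_eq p hp, mul_comm]
  have hcross : ∫ p in s, c₁ p * Real.log (c₁ p) ≤ ∫ p in s, c₂ p * Real.log (c₁ p) := by
    rw [← setIntegral_congr_fun hs (hf_mul c₁), ← setIntegral_congr_fun hs (hf_mul c₂)]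
    refine horder f (Real.measurable_log.comp (hm₁.comp hclamp_meas)) (fun p q => ?_)
      (hi₁.congr_fun (hf_mul c₁).symm hs) (hi₂.congr_fun (hf_mul c₂).symm hs)
    simp only [f]
    rw [hclamp_sup, hclamp_inf]
    exact hsm _ (hclamp_mem p) _ (hclamp_mem q)
  exact hcross.trans <| integral_mul_log_le_integral_mul_log_self hs hpos₁ hpos₂
    (Integrable.of_integral_ne_zero (by rw [hint₁]; exact one_ne_zero))
    (Integrable.of_integral_ne_zero (by rw [hint₂]; exact one_ne_zero))
    (hint₁.trans hint₂.symm) hi₂ hi₃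
end

section
/- Fix n ≥ 1 and let c₁, c₂ : (Fin n → ℝ) → ℝ be measurable functions, strictly positive on the unit cube [0,1]ⁿ, each integrating to 1 with respect to Lebesgue measure on [0,1]ⁿ. Assume: (i) the function u ↦ log c₁(u) is supermodular on [0,1]ⁿ; (ii) for every measurable supermodular function f : (Fin n → ℝ) → ℝ such that f·c₁ and f·c₂ are both Lebesgue-integrable on [0,1]ⁿ, one has ∫_{[0,1]ⁿ} f·c₁ ≤ ∫_{[0,1]ⁿ} f·c₂; (iii) the functions c₁·log c₁, c₂·log c₁, and c₂·log c₂ are all Lebesgue-integrable on [0,1]ⁿ. Then ∫_{[0,1]ⁿ} c₁ · log c₁ ≤ ∫_{[0,1]ⁿ} c₂ · log c₂. -/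
open MeasureTheory

/-- Gibbs' inequality: the negative entropy of a density `q` is at least its cross term with
any density `p` of the same total mass. -/
theorem integral_mul_log_le_integral_mul_log {α : Type*} [MeasurableSpace α] {μ : Measure α}
    {p q : α → ℝ} (hp : ∀ᵐ x ∂μ, 0 < p x) (hq : ∀ᵐ x ∂μ, 0 < q x)
    (hpi : Integrable p μ) (hqi : Integrable q μ) (hpq : ∫ x, p x ∂μ = ∫ x, q x ∂μ)
    (hqp : Integrable (fun x => q x * Real.log (p x)) μ)
    (hqq : Integrable (fun x => q x * Real.log (q x)) μ) :
    ∫ x, q x * Real.log (p x) ∂μ ≤ ∫ x, q x * Real.log (q x) ∂μ := by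
  have h : ∫ x, (q x * Real.log (p x) - q x * Real.log (q x)) ∂μ ≤ ∫ x, (p x - q x) ∂μ := by
    refine integral_mono_ae (hqp.sub hqq) (hpi.sub hqi) ?_
    filter_upwards [hp, hq] with x hpx hqx
    have hlog := Real.log_le_sub_one_of_pos (div_pos hpx hqx)
    rw [Real.log_div hpx.ne' hqx.ne'] at hlog
    calc q x * Real.log (p x) - q x * Real.log (q x)
        = q x * (Real.log (p x) - Real.log (q x)) := by ring
      _ ≤ q x * (p x / q x - 1) := mul_le_mul_of_nonneg_left hlog hqx.le
      _ = p x - q x := by field_simp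
  rw [integral_sub hqp hqq, integral_sub hpi hqi] at h
  linarith

/-- Multivariate version: if `c₁, c₂` are probability densities on the unit cube `[0,1]ⁿ`,
`log c₁` is supermodular on `[0,1]ⁿ`, and the density `c₂` dominates `c₁` in the
supermodular stochastic order, then the negative entropy of `c₁` is at most that of `c₂`. -/
theorem negentropy_le_of_supermodular_order_multivariate
    (n : ℕ) (hn : 1 ≤ n) (c₁ c₂ : (Fin n → ℝ) → ℝ)
    (hm₁ : Measurable c₁) (hm₂ : Measurable c₂)
    (hpos₁ : ∀ u ∈ Set.Icc (0 : Fin n → ℝ) 1, 0 < c₁ u)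
    (hpos₂ : ∀ u ∈ Set.Icc (0 : Fin n → ℝ) 1, 0 < c₂ u)
    (hint₁ : (∫ u in Set.Icc (0 : Fin n → ℝ) 1, c₁ u) = 1)
    (hint₂ : (∫ u in Set.Icc (0 : Fin n → ℝ) 1, c₂ u) = 1)
    -- (i) `log c₁` is supermodular on `[0,1]ⁿ`
    (hsm : ∀ u ∈ Set.Icc (0 : Fin n → ℝ) 1, ∀ v ∈ Set.Icc (0 : Fin n → ℝ) 1,
      Real.log (c₁ u) + Real.log (c₁ v) ≤
        Real.log (c₁ (u ⊔ v)) + Real.log (c₁ (u ⊓ v)))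
    -- (ii) supermodular stochastic order
    (horder : ∀ f : (Fin n → ℝ) → ℝ, Measurable f →
      (∀ u v : Fin n → ℝ, f u + f v ≤ f (u ⊔ v) + f (u ⊓ v)) →
      IntegrableOn (fun u => f u * c₁ u) (Set.Icc (0 : Fin n → ℝ) 1) →
      IntegrableOn (fun u => f u * c₂ u) (Set.Icc (0 : Fin n → ℝ) 1) →
      (∫ u in Set.Icc (0 : Fin n → ℝ) 1, f u * c₁ u) ≤
        ∫ u in Set.Icc (0 : Fin n → ℝ) 1, f u * c₂ u)
    -- (iii) integrability
    (hi₁ : IntegrableOn (fun u => c₁ u * Real.log (c₁ u)) (Set.Icc (0 : Fin n → ℝ) 1))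
    (hi₂ : IntegrableOn (fun u => c₂ u * Real.log (c₁ u)) (Set.Icc (0 : Fin n → ℝ) 1))
    (hi₃ : IntegrableOn (fun u => c₂ u * Real.log (c₂ u)) (Set.Icc (0 : Fin n → ℝ) 1)) :
    (∫ u in Set.Icc (0 : Fin n → ℝ) 1, c₁ u * Real.log (c₁ u)) ≤
      ∫ u in Set.Icc (0 : Fin n → ℝ) 1, c₂ u * Real.log (c₂ u) := by
  let r : (Fin n → ℝ) → (Fin n → ℝ) := fun u => (u ⊔ 0) ⊓ 1
  have hr_mem : ∀ u, r u ∈ Set.Icc (0 : Fin n → ℝ) 1 := fun u =>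
    ⟨le_inf le_sup_right zero_le_one, inf_le_right⟩
  have hr_eq : ∀ u ∈ Set.Icc (0 : Fin n → ℝ) 1, r u = u := fun u hu => by
    simp only [r, sup_eq_left.2 hu.1, inf_eq_left.2 hu.2]
  have hr_sup : ∀ u v, r (u ⊔ v) = r u ⊔ r v := fun u v => by
    simp only [r, ← inf_sup_right, ← sup_sup_distrib_right]
  have hr_inf : ∀ u v, r (u ⊓ v) = r u ⊓ r v := fun u v => by
    simp only [r, sup_inf_right, ← inf_inf_distrib_right]
  have hr_meas : Measurable r := measurable_pi_lambda r fun i =>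
    ((measurable_pi_apply i).sup_const 0).inf_const 1
  have hext : ∀ c : (Fin n → ℝ) → ℝ,
      Set.EqOn (fun u => Real.log (c₁ (r u)) * c u) (fun u => c u * Real.log (c₁ u))
        (Set.Icc (0 : Fin n → ℝ) 1) := fun c u hu => by
    simp only [hr_eq u hu, mul_comm]
  have hle := horder (fun u => Real.log (c₁ (r u))) (hm₁.comp hr_meas).log
    (fun u v => by
      simpa only [hr_sup, hr_inf] using hsm (r u) (hr_mem u) (r v) (hr_mem v))
    (hi₁.congr_fun (hext c₁).symm measurableSet_Icc)
    (hi₂.congr_fun (hext c₂).symm measurableSet_Icc)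
  rw [setIntegral_congr_fun measurableSet_Icc (hext c₁),
    setIntegral_congr_fun measurableSet_Icc (hext c₂)] at hle
  exact hle.trans <| integral_mul_log_le_integral_mul_log
    (ae_restrict_of_forall_mem measurableSet_Icc hpos₁)
    (ae_restrict_of_forall_mem measurableSet_Icc hpos₂)
    (.of_integral_ne_zero (by simp [hint₁])) (.of_integral_ne_zero (by simp [hint₂]))
    (hint₁.trans hint₂.symm) hi₂ hi₃
end

section
/- Let ψ : ℝ → ℝ be a function that is continuous and strictly decreasing on [0,∞), satisfies ψ(0) = 1 and ψ(t) → 0 as t → ∞, and is completely monotone on (0,∞). Let ψinv : (0,1] → [0,∞) be the inverse of the restriction of ψ to [0,∞) (so ψ(ψinv(u)) = u for all u ∈ (0,1]). Then there exists a probability measure M on (0,∞) such that for all u, v ∈ (0,1]: ψ(ψinv(u) + ψinv(v)) = ∫_{(0,∞)} (exp(-ψinv(u)))^α · (exp(-ψinv(v)))^α dM(α). In other words, the Archimedean copula C(u,v) = ψ(ψinv(u) + ψinv(v)) is a mixture ∫ G₁(u)^α G₂(v)^α dM(α) where G₁(u) = exp(-ψinv(u)) and G₂(v) = exp(-ψinv(v)).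 -/
/-- `f` is completely monotone on `(0,∞)`: it is infinitely differentiable there and
its iterated derivatives alternate in sign. -/
def CompletelyMonotoneOn (f : ℝ → ℝ) : Prop :=
  ContDiffOn ℝ (⊤ : ℕ∞) f (Set.Ioi 0) ∧
    ∀ n : ℕ, ∀ t : ℝ, 0 < t → 0 ≤ (-1 : ℝ) ^ n * iteratedDeriv n f t

open Filter MeasureTheory Set
open scoped Topology unitInterval

namespace CompletelyMonotoneOn

variable {f : ℝ → ℝ}

/-- The Poisson-type weight `(-1)ᵏ f⁽ᵏ⁾(a) aᵏ / k!`: the coefficient of `yᵏ` in the Taylor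
expansion of `y ↦ f (a * (1 - y))` at `0`. -/
noncomputable def weight (f : ℝ → ℝ) (a : ℝ) (k : ℕ) : ℝ :=
  (-1) ^ k * iteratedDeriv k f a * a ^ k / k.factorial

lemma weight_nonneg (hf : CompletelyMonotoneOn f) {a : ℝ} (ha : 0 < a) (k : ℕ) :
    0 ≤ weight f a k :=
  div_nonneg (mul_nonneg (hf.2 k a ha) (by positivity)) (by positivity)

lemma contDiffAt (hf : CompletelyMonotoneOn f) {t : ℝ} (ht : 0 < t) (n : ℕ) :
    ContDiffAt ℝ n f t :=
  (hf.1.contDiffAt (Ioi_mem_nhds ht)).of_le (by exact_mod_cast le_top)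

lemma contDiffOn_uIcc (hf : CompletelyMonotoneOn f) {a x : ℝ} (ha : 0 < a) (hx : 0 < x) (n : ℕ) :
    ContDiffOn ℝ n f (uIcc a x) := fun _ ht ↦
  (hf.contDiffAt ((lt_min ha hx).trans_le ht.1) n).contDiffWithinAt

lemma taylorWithinEval_eq (hf : CompletelyMonotoneOn f) {a x : ℝ} (ha : 0 < a) (hax : a ≠ x)
    (n : ℕ) : taylorWithinEval f n (uIcc a x) a x =
      ∑ k ∈ Finset.range (n + 1), weight f a k * (1 - x / a) ^ k := by
  rw [taylor_within_apply]
  refine Finset.sum_congr rfl fun k _ ↦ ?_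
  rw [iteratedDerivWithin_eq_iteratedDeriv (uniqueDiffOn_uIcc hax) (hf.contDiffAt ha k)
    left_mem_uIcc, weight, show x - a = (-1) * (a * (1 - x / a)) by field_simp; ring, mul_pow,
    mul_pow, smul_eq_mul]
  ring

lemma sum_weight_mul_pow_le (hf : CompletelyMonotoneOn f) {a x : ℝ} (hx : 0 < x) (hxa : x < a)
    (n : ℕ) : ∑ k ∈ Finset.range (n + 1), weight f a k * (1 - x / a) ^ k ≤ f x := by
  have ha := hx.trans hxa
  obtain ⟨ξ, hξ, h⟩ := taylor_mean_remainder_lagrange_iteratedDeriv hxa.ne'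
    (n := n) (by exact_mod_cast hf.contDiffOn_uIcc ha hx (n + 1))
  rw [hf.taylorWithinEval_eq ha hxa.ne'] at h
  have hξ0 : 0 < ξ := (lt_min ha hx).trans hξ.1
  have : 0 ≤ iteratedDeriv (n + 1) f ξ * (x - a) ^ (n + 1) / (n + 1).factorial := by
    rw [← neg_sub a x, neg_pow, ← mul_assoc, mul_comm (iteratedDeriv _ _ _)]
    exact div_nonneg (mul_nonneg (hf.2 _ _ hξ0) (pow_nonneg (by linarith) _)) (by positivity)
  linarith

lemma sum_weight_le (hf : CompletelyMonotoneOn f) {C : ℝ} (hC : ∀ t, 0 < t → f t ≤ C)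
    {a : ℝ} (ha : 0 < a) (n : ℕ) : ∑ k ∈ Finset.range n, weight f a k ≤ C := by
  have hlim : Tendsto (fun x ↦ ∑ k ∈ Finset.range (n + 1), weight f a k * (1 - x / a) ^ k)
      (𝓝[>] 0) (𝓝 (∑ k ∈ Finset.range (n + 1), weight f a k * (1 - 0 / a) ^ k)) :=
    tendsto_nhdsWithin_of_tendsto_nhds (Continuous.tendsto (by fun_prop) 0)
  have := le_of_tendsto hlim (b := C) (by
    filter_upwards [Ioo_mem_nhdsGT ha] with x hx
    exact (hf.sum_weight_mul_pow_le hx.1 hx.2 n).trans (hC x hx.1))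
  simp only [zero_div, sub_zero, one_pow, mul_one, Finset.sum_range_succ] at this
  linarith [hf.weight_nonneg ha n]

lemma weight_le (hf : CompletelyMonotoneOn f) {C : ℝ} (hC : ∀ t, 0 < t → f t ≤ C)
    {a : ℝ} (ha : 0 < a) (n : ℕ) : weight f a n ≤ C :=
  (Finset.single_le_sum (fun k _ ↦ hf.weight_nonneg ha k) (Finset.self_mem_range_succ n)).trans
    (hf.sum_weight_le hC ha (n + 1))

lemma sub_sum_weight_mul_pow_le (hf : CompletelyMonotoneOn f) {C : ℝ}
    (hC : ∀ t, 0 < t → f t ≤ C) {a x : ℝ} (hx : 0 < x) (hxa : x < a) (n : ℕ) :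
    f x - ∑ k ∈ Finset.range (n + 1), weight f a k * (1 - x / a) ^ k ≤
      C * ((n + 1) * (1 - x / a) ^ n * (a / x)) := by
  have ha := hx.trans hxa
  have hC0 : 0 ≤ C := (hf.weight_nonneg ha 0).trans (hf.weight_le hC ha 0)
  have hu := uniqueDiffOn_uIcc hxa.ne'
  obtain ⟨ξ, hξ, h⟩ := taylor_mean_remainder_cauchy (n := n) hxa.ne'
    (hf.contDiffOn_uIcc ha hx n)
    (((hf.contDiffOn_uIcc ha hx (n + 1)).differentiableOn_iteratedDerivWithin
      (by norm_cast; simp) hu).mono Ioo_subset_Icc_self)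
  rw [hf.taylorWithinEval_eq ha hxa.ne'] at h
  have hξ' : x < ξ ∧ ξ < a := by simpa [uIoo, hxa.le] using hξ
  have hξ0 : 0 < ξ := hx.trans hξ'.1
  rw [iteratedDerivWithin_eq_iteratedDeriv hu (hf.contDiffAt hξ0 _) (Ioo_subset_Icc_self hξ)] at h
  have key : iteratedDeriv (n + 1) f ξ * (x - ξ) ^ n / n.factorial * (x - a) =
      weight f ξ (n + 1) * ((n + 1) * (1 - x / ξ) ^ n * ((a - x) / ξ)) := by
    rw [weight, show x - ξ = (-1) * (ξ * (1 - x / ξ)) by field_simp; ring, mul_pow, mul_pow,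
      Nat.factorial_succ, pow_succ ξ, pow_succ (-1 : ℝ)]
    push_cast
    field_simp
    ring
  rw [h, key]
  have h1 : 0 ≤ 1 - x / ξ := sub_nonneg.2 ((div_le_one hξ0).2 hξ'.1.le)
  have h2 : 1 - x / ξ ≤ 1 - x / a := by gcongr; exact hξ'.2.le
  have h4 : 0 ≤ a - x := by linarith
  have h5 : (a - x) / ξ ≤ a / x := by gcongr; linarith; exact hξ'.1.le
  have h6 : 0 ≤ 1 - x / a := h1.trans h2
  gcongr
  exact hf.weight_le hC hξ0 _


/-- A discrete probability measure on `[0,1]` whose power moments are Taylor polynomials of a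
completely monotone function bounded by `1`; the missing mass sits at `0`. -/
lemma exists_discrete_measure (hf : CompletelyMonotoneOn f) (hC : ∀ t, 0 < t → f t ≤ 1)
    {a : ℝ} (ha : 0 < a) (n : ℕ) : ∃ μ : ProbabilityMeasure I, ∀ r : ℝ, 0 < r →
      ∫ s : I, (s : ℝ) ^ r ∂(μ : Measure I) =
        ∑ k ∈ Finset.range n, weight f a k * Real.exp (-r / a) ^ k := by
  have hmem (k : ℕ) : Real.exp (-k / a) ∈ I :=
    ⟨(Real.exp_pos _).le, Real.exp_le_one_iff.2 (div_nonpos_of_nonpos_of_nonneg (by simp) ha.le)⟩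
  have hp := fun k ↦ hf.weight_nonneg ha k
  let μ : Measure I := ∑ k ∈ Finset.range n,
    ENNReal.ofReal (weight f a k) • Measure.dirac (⟨_, hmem k⟩ : I) +
      ENNReal.ofReal (1 - ∑ k ∈ Finset.range n, weight f a k) • Measure.dirac 0
  have hμ : IsProbabilityMeasure μ := by
    constructor
    simp only [μ, Measure.add_apply, Measure.coe_finsetSum, Finset.sum_apply, Measure.smul_apply,
      measure_univ, smul_eq_mul, mul_one]
    rw [← ENNReal.ofReal_sum_of_nonneg fun k _ ↦ hp k, ← ENNReal.ofReal_add
      (Finset.sum_nonneg fun k _ ↦ hp k) (sub_nonneg.2 (hf.sum_weight_le hC ha n))]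
    simp
  refine ⟨⟨μ, hμ⟩, fun r hr ↦ ?_⟩
  have h_integrable (c : ℝ) (x : I) : Integrable (fun s : I ↦ (s : ℝ) ^ r)
      (ENNReal.ofReal c • Measure.dirac x) :=
    (integrable_dirac (by simp)).smul_measure ENNReal.ofReal_ne_top
  change ∫ s : I, (s : ℝ) ^ r ∂μ = _
  rw [integral_add_measure (integrable_finsetSum_measure.2 fun k _ ↦ h_integrable _ _) (h_integrable _ _),
    integral_finsetSum_measure fun k _ ↦ h_integrable _ _]
  simp only [integral_smul_measure, integral_dirac, ENNReal.toReal_ofReal (hp _), smul_eq_mul]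
  rw [Set.Icc.coe_zero, Real.zero_rpow hr.ne', mul_zero, add_zero]
  refine Finset.sum_congr rfl fun k _ ↦ ?_
  rw [← Real.exp_mul, ← Real.exp_nat_mul]
  ring_nf

lemma tendsto_mul_one_sub_exp (r : ℝ) :
    Tendsto (fun m : ℕ ↦ (m : ℝ) * (1 - Real.exp (-r / m))) atTop (𝓝 r) := by
  have h : HasDerivAt (fun x : ℝ ↦ -Real.exp (-r * x)) r 0 := by
    have := (((hasDerivAt_id (0 : ℝ)).const_mul (-r)).exp).fun_neg
    simpa using this
  have := h.tendsto_slope_zero.comp (tendsto_inv_atTop_nhdsGT_zero.mono_right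
    (nhdsWithin_mono _ fun x (hx : 0 < x) ↦ hx.ne') |>.comp tendsto_natCast_atTop_atTop)
  refine this.congr fun m ↦ ?_
  simp only [Function.comp_apply, zero_add, smul_eq_mul, inv_inv, mul_zero, Real.exp_zero,
    div_eq_mul_inv]
  ring

lemma tendsto_sum_weight (hf : CompletelyMonotoneOn f) {C : ℝ} (hC : ∀ t, 0 < t → f t ≤ C)
    {r : ℝ} (hr : 0 < r) :
    Tendsto (fun m : ℕ ↦ ∑ k ∈ Finset.range (m ^ 2 + 1), weight f m k * Real.exp (-r / m) ^ k)
      atTop (𝓝 (f r)) := by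
  have hx := tendsto_mul_one_sub_exp r
  have hfx := ((hf.contDiffAt hr 0).continuousAt.tendsto).comp hx
  have hexp : Tendsto (fun m : ℕ ↦ C * (((m : ℝ) ^ 2 + 1) * Real.exp (-r * m) *
      (m / (m * (1 - Real.exp (-r / m)))))) atTop (𝓝 0) := by
    have h3 := (tendsto_natCast_atTop_atTop (R := ℝ)).const_mul_atTop hr
    have h0 := ((Real.tendsto_pow_mul_exp_neg_atTop_nhds_zero 3).comp h3).const_mul (r ^ 3)⁻¹
    have h1 := ((Real.tendsto_pow_mul_exp_neg_atTop_nhds_zero 1).comp h3).const_mul r⁻¹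
    have := ((h0.add h1).mul (hx.inv₀ hr.ne')).const_mul C
    simp only [mul_zero, add_zero, zero_mul] at this
    refine this.congr fun m ↦ ?_
    simp only [Function.comp_apply, neg_mul]
    field_simp
  have hR : Tendsto (fun m : ℕ ↦ f (m * (1 - Real.exp (-r / m))) -
      ∑ k ∈ Finset.range (m ^ 2 + 1), weight f m k * Real.exp (-r / m) ^ k) atTop (𝓝 0) := by
    refine tendsto_of_tendsto_of_tendsto_of_le_of_le' tendsto_const_nhds hexp ?_ ?_ <;>
      filter_upwards [eventually_gt_atTop 0] with m hm <;>
      have hm' : (0 : ℝ) < m := by exact_mod_cast hm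
    all_goals
      have he : Real.exp (-r / m) < 1 := Real.exp_lt_one_iff.2 (div_neg_of_neg_of_pos (by linarith) hm')
      have hx0 : 0 < (m : ℝ) * (1 - Real.exp (-r / m)) := mul_pos hm' (by linarith)
      have hxm : (m : ℝ) * (1 - Real.exp (-r / m)) < m := by
        nlinarith [Real.exp_pos (-r / m)]
      have hy : 1 - (m : ℝ) * (1 - Real.exp (-r / m)) / m = Real.exp (-r / m) := by
        field_simp; ring
    · have := hf.sum_weight_mul_pow_le hx0 hxm (m ^ 2)
      rw [hy] at this
      linarith
    · have := hf.sub_sum_weight_mul_pow_le hC hx0 hxm (m ^ 2)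
      have hexp_eq : ((m ^ 2 : ℕ) : ℝ) * (-r / m) = -r * m := by push_cast; field_simp
      rw [hy, ← Real.exp_nat_mul (-r / m) (m ^ 2), hexp_eq, Nat.cast_pow] at this
      exact this
  simpa using hfx.sub hR

/-- The power form of the **Hausdorff–Bernstein–Widder theorem** on the compact space `[0,1]`. -/
lemma exists_measure_unitInterval (hf : CompletelyMonotoneOn f) (hC : ∀ t, 0 < t → f t ≤ 1) :
    ∃ μ : ProbabilityMeasure I, ∀ r : ℝ, 0 < r →
      ∫ s : I, (s : ℝ) ^ r ∂(μ : Measure I) = f r := by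
  choose μ hμ using fun m : ℕ ↦
    hf.exists_discrete_measure hC (a := m + 1) (by positivity) ((m + 1) ^ 2 + 1)
  obtain ⟨ν, -, hν⟩ := isCompact_univ.ultrafilter_le_nhds
    ((hyperfilter ℕ).map μ) (by simp)
  refine ⟨ν, fun r hr ↦ ?_⟩
  let g : BoundedContinuousFunction I ℝ := BoundedContinuousFunction.mkOfCompact
    ⟨fun s ↦ (s : ℝ) ^ r, continuous_subtype_val.rpow_const fun _ ↦ Or.inr hr.le⟩
  have h1 : Tendsto (fun m ↦ ∫ s, g s ∂(μ m : Measure I)) (hyperfilter ℕ)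
      (𝓝 (∫ s, g s ∂(ν : Measure I))) :=
    ProbabilityMeasure.tendsto_iff_forall_integral_tendsto.1 hν g
  have h2 := ((hf.tendsto_sum_weight hC hr).comp (tendsto_add_atTop_nat 1)).mono_left
    Nat.hyperfilter_le_atTop
  refine tendsto_nhds_unique h1 (h2.congr fun m ↦ ?_)
  simp only [Function.comp_apply, Nat.cast_add, Nat.cast_one]
  exact (hμ m r hr).symm

/-- **Bernstein's theorem** for a completely monotone function with `f(0⁺) = 1` and `f(∞) = 0`:
it is the Laplace transform of a probability measure on `(0,∞)`. -/
theorem exists_probabilityMeasure_integral_exp (hf : CompletelyMonotoneOn f)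
    (hC : ∀ t, 0 < t → f t ≤ 1) (h0 : Tendsto f (𝓝[>] 0) (𝓝 1))
    (htop : Tendsto f atTop (𝓝 0)) :
    ∃ M : Measure ℝ, IsProbabilityMeasure M ∧ M (Iic 0) = 0 ∧
      ∀ t, 0 < t → ∫ α in Ioi 0, Real.exp (-t * α) ∂M = f t := by
  obtain ⟨μ, hμ⟩ := hf.exists_measure_unitInterval hC
  have h_integrable (r : ℝ) (hr : 0 < r) : Integrable (fun s : I ↦ (s : ℝ) ^ r) (μ : Measure I) := by
    refine Integrable.of_bound (C := 1)
      (measurable_subtype_coe.pow_const r).aestronglyMeasurable (.of_forall fun s ↦ ?_)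
    rw [Real.norm_of_nonneg (Real.rpow_nonneg s.2.1 r)]
    exact Real.rpow_le_one s.2.1 s.2.2 hr.le
  have hzero : (μ : Measure I) {0} = 0 := by
    rw [← measureReal_eq_zero_iff]
    refine le_antisymm ?_ measureReal_nonneg
    have hle : ∀ r, 0 < r → f r ≤ 1 - (μ : Measure I).real {0} := fun r hr ↦ by
      rw [← probReal_compl_eq_one_sub (measurableSet_singleton _), ← hμ r hr,
        ← integral_indicator_one (measurableSet_singleton _).compl]
      refine integral_mono (h_integrable r hr)
        ((integrable_const 1).indicator (measurableSet_singleton _).compl) fun s ↦ ?_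
      by_cases hs : s = 0
      · simp [hs, Real.zero_rpow hr.ne']
      · simpa [hs] using Real.rpow_le_one s.2.1 s.2.2 hr.le
    have := le_of_tendsto h0 (by filter_upwards [self_mem_nhdsWithin] with r hr using hle r hr)
    linarith
  have hone : (μ : Measure I) {1} = 0 := by
    rw [← measureReal_eq_zero_iff]
    refine le_antisymm (ge_of_tendsto htop ?_) measureReal_nonneg
    filter_upwards [eventually_gt_atTop 0] with r hr
    rw [← hμ r hr, ← integral_indicator_one (measurableSet_singleton _)]
    refine integral_mono ((integrable_const 1).indicator (measurableSet_singleton _))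
      (h_integrable r hr) fun s ↦ ?_
    by_cases hs : s = 1
    · simp [hs]
    · simpa [hs] using Real.rpow_nonneg s.2.1 r
  have hmeas : Measurable fun s : I ↦ -Real.log s := by fun_prop
  have hM0 : (μ : Measure I).map (fun s : I ↦ -Real.log s) (Iic 0) = 0 := by
    rw [Measure.map_apply hmeas measurableSet_Iic]
    refine measure_mono_null (t := {0} ∪ {1}) (fun s hs ↦ ?_) (measure_union_null hzero hone)
    by_contra hs'
    simp only [mem_union, mem_singleton_iff, not_or] at hs'
    have := Real.log_neg (unitInterval.pos_iff_ne_zero.2 hs'.1)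
      (unitInterval.lt_one_iff_ne_one.2 hs'.2)
    simp only [mem_preimage, mem_Iic] at hs
    linarith
  refine ⟨(μ : Measure I).map fun s : I ↦ -Real.log s,
    Measure.isProbabilityMeasure_map hmeas.aemeasurable, hM0, fun t ht ↦ ?_⟩
  have hae : ∀ᵐ α ∂(μ : Measure I).map (fun s : I ↦ -Real.log s), α ∈ Ioi (0 : ℝ) := by
    simpa [ae_iff, Iic_def] using hM0
  rw [Measure.restrict_eq_self_of_ae_mem hae, integral_map hmeas.aemeasurable (by fun_prop),
    ← hμ t ht]
  refine integral_congr_ae ?_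
  filter_upwards [measure_eq_zero_iff_ae_notMem.1 hzero] with s hs
  rw [Real.rpow_def_of_pos (unitInterval.pos_iff_ne_zero.2 hs)]
  ring_nf

end CompletelyMonotoneOn

/-- An Archimedean copula whose generator `ψ` is completely monotone with `ψ 0 = 1`
is a mixture of powers: there is a probability measure `M` on `(0,∞)` such that
`ψ (ψ⁻¹ u + ψ⁻¹ v) = ∫ G₁(u)^α G₂(v)^α dM(α)` with `G₁(u) = exp (-ψ⁻¹ u)`,
`G₂(v) = exp (-ψ⁻¹ v)`. -/
theorem archimedean_copula_mixture (ψ ψinv : ℝ → ℝ)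
    (hcont : ContinuousOn ψ (Set.Ici 0))
    (hanti : StrictAntiOn ψ (Set.Ici 0))
    (hψ0 : ψ 0 = 1)
    (hlim : Filter.Tendsto ψ Filter.atTop (nhds 0))
    (hcm : CompletelyMonotoneOn ψ)
    (hinv_mem : ∀ u ∈ Set.Ioc (0 : ℝ) 1, 0 ≤ ψinv u)
    (hinv : ∀ u ∈ Set.Ioc (0 : ℝ) 1, ψ (ψinv u) = u) :
    ∃ M : MeasureTheory.Measure ℝ, MeasureTheory.IsProbabilityMeasure M ∧
      M (Set.Iic 0) = 0 ∧
      ∀ u ∈ Set.Ioc (0 : ℝ) 1, ∀ v ∈ Set.Ioc (0 : ℝ) 1,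
        ψ (ψinv u + ψinv v) =
          ∫ α in Set.Ioi (0 : ℝ),
            Real.exp (-ψinv u) ^ α * Real.exp (-ψinv v) ^ α ∂M := by
  have h0 : Tendsto ψ (𝓝[>] 0) (𝓝 1) :=
    hψ0 ▸ (hcont 0 self_mem_Ici).mono_left (nhdsWithin_mono _ Ioi_subset_Ici_self)
  obtain ⟨M, hM, hM0, hMint⟩ := hcm.exists_probabilityMeasure_integral_exp
    (fun t ht ↦ hψ0 ▸ (hanti self_mem_Ici ht.le ht).le) h0 hlim
  refine ⟨M, hM, hM0, fun u hu v hv ↦ ?_⟩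
  have hexp (α : ℝ) : Real.exp (-ψinv u) ^ α * Real.exp (-ψinv v) ^ α =
      Real.exp (-(ψinv u + ψinv v) * α) := by
    rw [← Real.exp_mul, ← Real.exp_mul, ← Real.exp_add]
    ring_nf
  simp only [hexp]
  rcases (add_nonneg (hinv_mem u hu) (hinv_mem v hv)).eq_or_lt with h | h
  · have hIoi : M (Ioi 0) = 1 := by
      rw [← compl_Iic, prob_compl_eq_one_sub measurableSet_Iic, hM0, tsub_zero]
    simp [← h, hψ0, measureReal_def, hIoi]
  · exact (hMint _ h).symm
end

section
/- Fix n ≥ 1. Let M be a finite measure on (0,∞), let G₁, …, Gₙ : ℝ → ℝ be nondecreasing and strictly positive, and let g₁, …, gₙ : ℝ → ℝ be nonnegative. Define c : (Fin n → ℝ) → ℝ by c(u) = (∏_{i} g_i(u_i)) · ∫_{(0,∞)} α^n · ∏_{i} G_i(u_i)^{α-1} dM(α), and assume the integrand is M-integrable for every u. Then c is multivariate TP2: for all x, y ∈ (Fin n → ℝ), c(x ⊔ y) · c(x ⊓ y) ≥ c(x) · c(y). -/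
open MeasureTheory

/-- The density of an `n`-dimensional Archimedean copula written as a mixture:
`c u = (∏ i, gᵢ (uᵢ)) * ∫_{(0,∞)} αⁿ ∏ i, Gᵢ(uᵢ)^(α-1) dM(α)`. -/
noncomputable def mixtureDensity (n : ℕ) (M : Measure ℝ)
    (G g : Fin n → ℝ → ℝ) (u : Fin n → ℝ) : ℝ :=
  (∏ i, g i (u i)) *
    ∫ α in Set.Ioi (0 : ℝ), (α ^ n) * ∏ i, G i (u i) ^ (α - 1) ∂M

theorem add_le_add_of_mul_eq_mul {p q r s : ℝ} (hr : 0 < r) (hpr : p ≤ r) (hqr : q ≤ r)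
    (h : r * s = p * q) : p + q ≤ r + s := by
  refine le_of_mul_le_mul_left ?_ hr
  nlinarith [mul_nonneg (sub_nonneg.2 hpr) (sub_nonneg.2 hqr)]

theorem rpow_mul_add_rpow_mul_le {p q r s : ℝ} (hp : 0 < p) (hq : 0 < q) (hs : 0 < s)
    (hpr : p ≤ r) (hqr : q ≤ r) (h : r * s = p * q) (a b : ℝ) :
    p ^ a * q ^ b + p ^ b * q ^ a ≤ r ^ a * s ^ b + r ^ b * s ^ a := by
  wlog hab : b ≤ a generalizing a b
  · linarith [this b a (le_of_not_ge hab)]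
  have hr : 0 < r := hp.trans_le hpr
  have hpow (t : ℝ) : r ^ t * s ^ t = p ^ t * q ^ t := by
    rw [← Real.mul_rpow hr.le hs.le, h, Real.mul_rpow hp.le hq.le]
  have hsub : 0 ≤ a - b := sub_nonneg.2 hab
  have hsum : p ^ (a - b) + q ^ (a - b) ≤ r ^ (a - b) + s ^ (a - b) :=
    add_le_add_of_mul_eq_mul (Real.rpow_pos_of_pos hr _)
      (Real.rpow_le_rpow hp.le hpr hsub) (Real.rpow_le_rpow hq.le hqr hsub) (hpow _)
  have hsplit {z : ℝ} (hz : 0 < z) : z ^ a = z ^ (a - b) * z ^ b := by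
    rw [← Real.rpow_add hz, sub_add_cancel]
  rw [hsplit hp, hsplit hq, hsplit hr, hsplit hs]
  calc p ^ (a - b) * p ^ b * q ^ b + p ^ b * (q ^ (a - b) * q ^ b)
      = (p ^ b * q ^ b) * (p ^ (a - b) + q ^ (a - b)) := by ring
    _ ≤ (p ^ b * q ^ b) * (r ^ (a - b) + s ^ (a - b)) := by gcongr
    _ = (r ^ b * s ^ b) * (r ^ (a - b) + s ^ (a - b)) := by rw [hpow]
    _ = r ^ (a - b) * r ^ b * s ^ b + r ^ b * (s ^ (a - b) * s ^ b) := by ring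

/-- Integrating a symmetrized pointwise inequality of products over the product measure. -/
theorem setIntegral_mul_setIntegral_le {X : Type*} [MeasurableSpace X] {μ : Measure X} [SFinite μ]
    {S : Set X} (hS : MeasurableSet S) {f₁ f₂ f₃ f₄ : X → ℝ}
    (h₁ : IntegrableOn f₁ S μ) (h₂ : IntegrableOn f₂ S μ)
    (h₃ : IntegrableOn f₃ S μ) (h₄ : IntegrableOn f₄ S μ)
    (h : ∀ a ∈ S, ∀ b ∈ S, f₁ a * f₂ b + f₁ b * f₂ a ≤ f₃ a * f₄ b + f₃ b * f₄ a) :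
    (∫ a in S, f₁ a ∂μ) * ∫ a in S, f₂ a ∂μ ≤ (∫ a in S, f₃ a ∂μ) * ∫ a in S, f₄ a ∂μ := by
  have hint {f g : X → ℝ} (hf : IntegrableOn f S μ) (hg : IntegrableOn g S μ) :
      Integrable (fun z : X × X => f z.1 * g z.2) ((μ.restrict S).prod (μ.restrict S)) :=
    Integrable.mul_prod hf hg
  have hint' {f g : X → ℝ} (hf : IntegrableOn f S μ) (hg : IntegrableOn g S μ) :
      Integrable (fun z : X × X => f z.2 * g z.1) ((μ.restrict S).prod (μ.restrict S)) :=
    (hint hf hg).swap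
  have hval (f g : X → ℝ) (hf : IntegrableOn f S μ) (hg : IntegrableOn g S μ) :
      ∫ z : X × X, (f z.1 * g z.2 + f z.2 * g z.1) ∂(μ.restrict S).prod (μ.restrict S) =
        2 * ((∫ a in S, f a ∂μ) * ∫ a in S, g a ∂μ) := by
    rw [integral_add (hint hf hg) (hint' hf hg), integral_prod_mul]
    simp_rw [mul_comm (f _) (g _)]
    rw [integral_prod_mul]
    ring
  have hle : ∫ z : X × X, (f₁ z.1 * f₂ z.2 + f₁ z.2 * f₂ z.1)
        ∂(μ.restrict S).prod (μ.restrict S) ≤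
      ∫ z : X × X, (f₃ z.1 * f₄ z.2 + f₃ z.2 * f₄ z.1)
        ∂(μ.restrict S).prod (μ.restrict S) := by
    refine integral_mono_ae ((hint h₁ h₂).add (hint' h₁ h₂)) ((hint h₃ h₄).add (hint' h₃ h₄)) ?_
    rw [Measure.prod_restrict]
    filter_upwards [ae_restrict_mem (hS.prod hS)] with z hz
    exact h z.1 hz.1 z.2 hz.2
  rw [hval f₁ f₂ h₁ h₂, hval f₃ f₄ h₃ h₄] at hle
  linarith

theorem prod_apply_sup_mul_prod_apply_inf {n : ℕ} (f : Fin n → ℝ → ℝ) (x y : Fin n → ℝ) :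
    (∏ i, f i ((x ⊔ y) i)) * ∏ i, f i ((x ⊓ y) i) = (∏ i, f i (x i)) * ∏ i, f i (y i) := by
  simp_rw [← Finset.prod_mul_distrib]
  refine Finset.prod_congr rfl fun i _ => ?_
  rcases le_total (x i) (y i) with hxy | hxy <;> simp [hxy, mul_comm]

/-- The density of an Archimedean copula with a mixture representation is
multivariate TP2. -/
theorem mixtureDensity_MTP2 (n : ℕ) (hn : 1 ≤ n) (M : Measure ℝ)
    (hM : IsFiniteMeasure M) (G g : Fin n → ℝ → ℝ)
    (hGmono : ∀ i, Monotone (G i)) (hGpos : ∀ i x, 0 < G i x)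
    (hgnonneg : ∀ i x, 0 ≤ g i x)
    (hint : ∀ u : Fin n → ℝ,
      IntegrableOn (fun α => (α ^ n) * ∏ i, G i (u i) ^ (α - 1)) (Set.Ioi 0) M) :
    ∀ x y : Fin n → ℝ,
      mixtureDensity n M G g x * mixtureDensity n M G g y ≤
        mixtureDensity n M G g (x ⊔ y) * mixtureDensity n M G g (x ⊓ y) := by
  intro x y
  let P (u : Fin n → ℝ) : ℝ := ∏ i, G i (u i)
  have hPpos (u) : 0 < P u := Finset.prod_pos fun i _ => hGpos i (u i)
  have hPmono {u v : Fin n → ℝ} (huv : u ≤ v) : P u ≤ P v :=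
    Finset.prod_le_prod (fun i _ => (hGpos i _).le) fun i _ => hGmono i (huv i)
  have hrpow (u : Fin n → ℝ) (t : ℝ) : ∏ i, G i (u i) ^ t = P u ^ t :=
    Real.finsetProd_rpow _ _ (fun i _ => (hGpos i _).le) t
  simp only [mixtureDensity, hrpow] at hint ⊢
  have hI := setIntegral_mul_setIntegral_le measurableSet_Ioi
    (hint x) (hint y) (hint (x ⊔ y)) (hint (x ⊓ y)) fun a ha b hb => by
      have hab : 0 ≤ a ^ n * b ^ n :=
        mul_nonneg (pow_nonneg (le_of_lt ha) n) (pow_nonneg (le_of_lt hb) n)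
      have := mul_le_mul_of_nonneg_left
        (rpow_mul_add_rpow_mul_le (hPpos x) (hPpos y) (hPpos (x ⊓ y)) (hPmono le_sup_left)
          (hPmono le_sup_right) (prod_apply_sup_mul_prod_apply_inf G x y) (a - 1) (b - 1)) hab
      linarith
  rw [mul_mul_mul_comm, mul_mul_mul_comm (∏ i, g i ((x ⊔ y) i)),
    prod_apply_sup_mul_prod_apply_inf]
  exact mul_le_mul_of_nonneg_left hI (mul_nonneg
    (Finset.prod_nonneg fun i _ => hgnonneg i _) (Finset.prod_nonneg fun i _ => hgnonneg i _))
end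

section
/- Let g : ℝ → ℝ be completely monotone on (0,∞), let I ⊆ ℝ be an open interval containing the image g((0,∞)), and let f : ℝ → ℝ be infinitely differentiable on I with all iterated derivatives nonnegative on I (i.e., f is absolutely monotone on I: iteratedDeriv k f x ≥ 0 for all k ≥ 0 and x ∈ I). Then the composition f ∘ g is completely monotone on (0,∞). -/
theorem neg_one_pow_mul_iteratedDeriv_comp_nonneg {g : ℝ → ℝ} {s I : Set ℝ} (hs : IsOpen s)
    (hI : IsOpen I) (hg : ContDiffOn ℝ (⊤ : ℕ∞) g s)
    (hgsign : ∀ n : ℕ, ∀ t ∈ s, 0 ≤ (-1 : ℝ) ^ (n + 1) * iteratedDeriv (n + 1) g t)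
    (hmaps : Set.MapsTo g s I) (n : ℕ) :
    ∀ f : ℝ → ℝ, ContDiffOn ℝ (⊤ : ℕ∞) f I → (∀ k : ℕ, ∀ x ∈ I, 0 ≤ iteratedDeriv k f x) →
      ∀ t ∈ s, 0 ≤ (-1 : ℝ) ^ n * iteratedDeriv n (f ∘ g) t := by
  induction n using Nat.strong_induction_on with
  | _ n ih =>
    intro f hf hfabs t ht
    cases n with
    | zero => simpa using hfabs 0 (g t) (hmaps ht)
    | succ n =>
      have hf' : ContDiffOn ℝ (⊤ : ℕ∞) (deriv f) I := hf.deriv_of_isOpen hI (by simp)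
      have hg' : ContDiffOn ℝ (⊤ : ℕ∞) (deriv g) s := hg.deriv_of_isOpen hs (by simp)
      have hderiv : Set.EqOn (deriv (f ∘ g)) ((deriv f ∘ g) * deriv g) s := fun x hx ↦
        deriv_comp x
          ((hf.differentiableOn (by simp)).differentiableAt (hI.mem_nhds (hmaps hx)))
          ((hg.differentiableOn (by simp)).differentiableAt (hs.mem_nhds hx))
      have hle : ((n : ℕ∞) : WithTop ℕ∞) ≤ ((⊤ : ℕ∞) : WithTop ℕ∞) := by exact_mod_cast le_top
      rw [iteratedDeriv_succ', hderiv.iteratedDeriv_of_isOpen hs n ht,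
        iteratedDeriv_mul
          (((hf'.comp hg hmaps).contDiffAt (hs.mem_nhds ht)).of_le hle)
          ((hg'.contDiffAt (hs.mem_nhds ht)).of_le hle), Finset.mul_sum]
      refine Finset.sum_nonneg fun i hi ↦ ?_
      have hin : i ≤ n := Nat.lt_succ_iff.mp (Finset.mem_range.mp hi)
      have hcomp := ih i (Nat.lt_succ_of_le hin) (deriv f) hf'
        (fun k x hx ↦ by simpa [iteratedDeriv_succ'] using hfabs (k + 1) x hx) t ht
      have hgi := hgsign (n - i) t ht
      rw [iteratedDeriv_succ'] at hgi
      have hpow : (-1 : ℝ) ^ (n + 1) = (-1) ^ i * (-1) ^ (n - i + 1) := by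
        rw [← pow_add]
        congr 1
        omega
      calc (0 : ℝ) ≤ (n.choose i : ℝ) * (((-1) ^ i * iteratedDeriv i (deriv f ∘ g) t) *
            ((-1) ^ (n - i + 1) * iteratedDeriv (n - i) (deriv g) t)) :=
          mul_nonneg (Nat.cast_nonneg _) (mul_nonneg hcomp hgi)
        _ = _ := by rw [hpow]; ring

/-- If `g` is completely monotone on `(0,∞)` and `f` is absolutely monotone on an open
interval `I` containing the image of `(0,∞)` under `g`, then `f ∘ g` is completely
monotone on `(0,∞)`. -/
theorem completelyMonotone_comp_absolutelyMonotone (f g : ℝ → ℝ) (I : Set ℝ)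
    (hgcm : CompletelyMonotoneOn g)
    (hIopen : IsOpen I) (hIinterval : Set.OrdConnected I)
    (hmaps : Set.MapsTo g (Set.Ioi 0) I)
    (hfsmooth : ContDiffOn ℝ (⊤ : ℕ∞) f I)
    (hfabs : ∀ k : ℕ, ∀ x ∈ I, 0 ≤ iteratedDeriv k f x) :
    CompletelyMonotoneOn (f ∘ g) := by
  exact ⟨hfsmooth.comp hgcm.1 hmaps, fun n t ht ↦
    neg_one_pow_mul_iteratedDeriv_comp_nonneg isOpen_Ioi hIopen hgcm.1
      (fun m x hx ↦ hgcm.2 (m + 1) x hx) hmaps n f hfsmooth hfabs t ht⟩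
end

section
/- Let f : ℝ → ℝ be completely monotone on (0,∞), and let g : ℝ → ℝ be strictly positive on (0,∞), infinitely differentiable on (0,∞), and such that its derivative g' is completely monotone on (0,∞). Then the composition f ∘ g is completely monotone on (0,∞). -/
/-- The negated derivative of a completely monotone function is completely monotone. -/
lemma CompletelyMonotoneOn.neg_deriv {f : ℝ → ℝ} (hf : CompletelyMonotoneOn f) :
    CompletelyMonotoneOn (-deriv f) := by
  refine ⟨(hf.1.deriv_of_isOpen isOpen_Ioi (by simp)).neg, fun n t ht => ?_⟩
  have h := hf.2 (n + 1) t ht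
  rw [iteratedDeriv_succ', pow_succ] at h
  rw [iteratedDeriv_neg]
  linarith

/-- The derivatives of a composition `f ∘ g` alternate in sign when `f` and `deriv g` are
completely monotone. -/
lemma CompletelyMonotoneOn.iteratedDeriv_comp_sign {g : ℝ → ℝ}
    (hgpos : ∀ t : ℝ, 0 < t → 0 < g t)
    (hgsmooth : ContDiffOn ℝ (⊤ : ℕ∞) g (Set.Ioi 0))
    (hg' : CompletelyMonotoneOn (deriv g)) (n : ℕ) :
    ∀ f : ℝ → ℝ, CompletelyMonotoneOn f → ∀ t : ℝ, 0 < t →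
      0 ≤ (-1 : ℝ) ^ n * iteratedDeriv n (f ∘ g) t := by
  induction n using Nat.strong_induction_on with
  | _ n ih =>
    intro f hf t ht
    cases n with
    | zero => simpa using hf.2 0 (g t) (hgpos t ht)
    | succ n =>
      have hF := hf.neg_deriv
      have hderiv : deriv (f ∘ g) =ᶠ[nhds t] -((-deriv f ∘ g) * deriv g) := by
        filter_upwards [Ioi_mem_nhds ht] with s hs
        have hfs : DifferentiableAt ℝ f (g s) :=
          (hf.1.contDiffAt (Ioi_mem_nhds (hgpos s hs))).differentiableAt (by simp)
        have hgs : DifferentiableAt ℝ g s :=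
          (hgsmooth.contDiffAt (Ioi_mem_nhds hs)).differentiableAt (by simp)
        simp [deriv_comp s hfs hgs]
      have hFg : ContDiffAt ℝ n (-deriv f ∘ g) t :=
        ((hF.1.comp hgsmooth hgpos).contDiffAt (Ioi_mem_nhds ht)).of_le
          (by exact_mod_cast le_top)
      have hg't : ContDiffAt ℝ n (deriv g) t :=
        (hg'.1.contDiffAt (Ioi_mem_nhds ht)).of_le (by exact_mod_cast le_top)
      rw [iteratedDeriv_succ', hderiv.iteratedDeriv_eq, iteratedDeriv_neg,
        iteratedDeriv_mul hFg hg't, pow_succ, mul_neg_one, neg_mul_neg, Finset.mul_sum]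
      refine Finset.sum_nonneg fun i hi => ?_
      have hi : i ≤ n := Nat.lt_succ_iff.mp (Finset.mem_range.mp hi)
      have h₁ := ih i (Nat.lt_succ_of_le hi) _ hF t ht
      have h₂ := hg'.2 (n - i) t ht
      calc (0 : ℝ) ≤ n.choose i * (((-1) ^ i * iteratedDeriv i (-deriv f ∘ g) t) *
            ((-1) ^ (n - i) * iteratedDeriv (n - i) (deriv g) t)) := by positivity
        _ = _ := by
          rw [← pow_mul_pow_sub (-1 : ℝ) hi]
          ring

/-- If `f` is completely monotone on `(0,∞)` and `g` is positive and smooth on `(0,∞)`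
with a completely monotone derivative, then `f ∘ g` is completely monotone on `(0,∞)`. -/
theorem completelyMonotone_comp_of_deriv_completelyMonotone (f g : ℝ → ℝ)
    (hf : CompletelyMonotoneOn f)
    (hgpos : ∀ t : ℝ, 0 < t → 0 < g t)
    (hgsmooth : ContDiffOn ℝ (⊤ : ℕ∞) g (Set.Ioi 0))
    (hg' : CompletelyMonotoneOn (deriv g)) :
    CompletelyMonotoneOn (f ∘ g) := by
  exact ⟨hf.1.comp hgsmooth hgpos,
    fun n => CompletelyMonotoneOn.iteratedDeriv_comp_sign hgpos hgsmooth hg' n f hf⟩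
end

section
/- For every θ ∈ (0,1], the generator of the bivariate Ali–Mikhail–Haq (AMH) copula, ψ_θ(t) = (1 - θ) / (exp(t) - θ), is completely monotone on (0,∞). -/
open Polynomial in
/-- If `g` has derivative `-q(g)` on an open set, where the polynomial `q`
has nonnegative coefficients, then every iterated derivative of `c * g` there is, up to
alternating sign and the factor `c`, a polynomial with nonnegative coefficients in `g`. -/
theorem exists_polynomial_iteratedDeriv_eq {s : Set ℝ} (hs : IsOpen s) {g : ℝ → ℝ} {q : ℝ[X]}
    (hq : ∀ k, 0 ≤ q.coeff k) (hg : ∀ t ∈ s, HasDerivAt g (-q.eval (g t)) t) (c : ℝ) (n : ℕ) :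
    ∃ p : ℝ[X], (∀ k, 0 ≤ p.coeff k) ∧
      ∀ t ∈ s, iteratedDeriv n (fun t => c * g t) t = (-1) ^ n * (c * p.eval (g t)) := by
  induction n with
  | zero =>
    refine ⟨X, fun k => ?_, fun t _ => by simp⟩
    rw [coeff_X]
    split_ifs <;> norm_num
  | succ n ih =>
    obtain ⟨p, hp, h⟩ := ih
    refine ⟨derivative p * q, fun k => ?_, fun t ht => ?_⟩
    · rw [coeff_mul]
      refine Finset.sum_nonneg fun i _ => mul_nonneg ?_ (hq _)
      rw [coeff_derivative]
      exact mul_nonneg (hp _) (by positivity)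
    · have heq : iteratedDeriv n (fun t => c * g t) =ᶠ[nhds t]
          fun t => (-1) ^ n * (c * p.eval (g t)) :=
        Filter.eventuallyEq_of_mem (hs.mem_nhds ht) h
      have hd : HasDerivAt (fun t => p.eval (g t)) _ t :=
        (p.hasDerivAt (g t)).comp t (hg t ht)
      rw [iteratedDeriv_succ, heq.deriv_eq, ((hd.const_mul c).const_mul ((-1) ^ n)).deriv,
        eval_mul]
      ring

theorem Polynomial.eval_nonneg_of_coeff_nonneg {p : Polynomial ℝ} (hp : ∀ k, 0 ≤ p.coeff k)
    {x : ℝ} (hx : 0 ≤ x) : 0 ≤ p.eval x := by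
  rw [Polynomial.eval_eq_sum_range]
  exact Finset.sum_nonneg fun i _ => mul_nonneg (hp i) (pow_nonneg hx i)

/-- The generator of the bivariate Ali–Mikhail–Haq copula,
`ψ_θ(t) = (1 - θ) / (exp t - θ)`, is completely monotone on `(0,∞)` for `θ ∈ (0,1]`. -/
theorem amh_generator_completelyMonotone (θ : ℝ) (hθ : θ ∈ Set.Ioc (0 : ℝ) 1) :
    CompletelyMonotoneOn (fun t => (1 - θ) / (Real.exp t - θ)) := by
  obtain ⟨hθ0, hθ1⟩ := hθ
  have hpos : ∀ t ∈ Set.Ioi (0 : ℝ), 0 < Real.exp t - θ := fun t ht => by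
    linarith [Real.one_lt_exp_iff.2 ht]
  refine ⟨contDiffOn_const.div (Real.contDiff_exp.contDiffOn.sub contDiffOn_const)
    fun t ht => (hpos t ht).ne', fun n t ht => ?_⟩
  have hq : ∀ k, 0 ≤ (Polynomial.X + Polynomial.C θ * Polynomial.X ^ 2).coeff k := fun k => by
    rw [Polynomial.coeff_add, Polynomial.coeff_X, Polynomial.coeff_C_mul_X_pow]
    split_ifs <;> linarith
  have hg : ∀ t ∈ Set.Ioi (0 : ℝ), HasDerivAt (fun t => (Real.exp t - θ)⁻¹)
      (-(Polynomial.X + Polynomial.C θ * Polynomial.X ^ 2).eval (Real.exp t - θ)⁻¹) t :=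
    fun t ht => by
      have hne := (hpos t ht).ne'
      refine (((Real.hasDerivAt_exp t).sub_const θ).fun_inv hne).congr_deriv ?_
      simp only [Polynomial.eval_add, Polynomial.eval_mul, Polynomial.eval_pow,
        Polynomial.eval_X, Polynomial.eval_C]
      field_simp
      ring
  obtain ⟨p, hp, h⟩ := exists_polynomial_iteratedDeriv_eq isOpen_Ioi hq hg (1 - θ) n
  simp only [div_eq_mul_inv]
  rw [h t ht, ← mul_assoc, ← mul_pow, neg_one_mul, neg_neg, one_pow, one_mul]
  exact mul_nonneg (by linarith)
    (Polynomial.eval_nonneg_of_coeff_nonneg hp (inv_nonneg.2 (hpos t ht).le))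
end

section
/- For every θ ≥ 1, the generator of the bivariate Joe copula, ψ_θ(t) = 1 - (1 - exp(-t))^{1/θ}, is completely monotone on (0,∞). -/
/-- The family `e^(-jt) (1 - e^(-t))^(a - j)`, whose cone of nonnegative combinations over `j ≥ 1`
is stable under `-d/dt` when `a ≤ 1`. -/
noncomputable def joeTerm (a : ℝ) (j : ℕ) (t : ℝ) : ℝ :=
  Real.exp (-(j * t)) * (1 - Real.exp (-t)) ^ (a - j)

theorem one_sub_exp_neg_pos {t : ℝ} (ht : 0 < t) : 0 < 1 - Real.exp (-t) :=
  sub_pos.2 (Real.exp_lt_one_iff.2 (neg_lt_zero.2 ht))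

theorem contDiffAt_one_sub_exp_neg_rpow (p : ℝ) {n : WithTop ℕ∞} {t : ℝ} (ht : 0 < t) :
    ContDiffAt ℝ n (fun t => (1 - Real.exp (-t)) ^ p) t :=
  ContDiffAt.rpow_const_of_ne (by fun_prop) (one_sub_exp_neg_pos ht).ne'

theorem hasDerivAt_one_sub_exp_neg_rpow (p : ℝ) {t : ℝ} (ht : 0 < t) :
    HasDerivAt (fun t => (1 - Real.exp (-t)) ^ p)
      (p * (Real.exp (-t) * (1 - Real.exp (-t)) ^ (p - 1))) t := by
  have h : HasDerivAt (fun t => 1 - Real.exp (-t)) (Real.exp (-t)) t := by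
    simpa using (hasDerivAt_neg t).exp.const_sub 1
  convert h.rpow_const (p := p) (Or.inl (one_sub_exp_neg_pos ht).ne') using 1
  ring

theorem contDiffAt_joeTerm (a : ℝ) (j : ℕ) {n : WithTop ℕ∞} {t : ℝ} (ht : 0 < t) :
    ContDiffAt ℝ n (joeTerm a j) t :=
  ContDiffAt.mul (by fun_prop) (contDiffAt_one_sub_exp_neg_rpow _ ht)

theorem joeTerm_nonneg (a : ℝ) (j : ℕ) {t : ℝ} (ht : 0 < t) : 0 ≤ joeTerm a j t :=
  mul_nonneg (Real.exp_pos _).le (Real.rpow_nonneg (one_sub_exp_neg_pos ht).le _)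

theorem deriv_joeTerm (a : ℝ) (j : ℕ) {t : ℝ} (ht : 0 < t) :
    deriv (joeTerm a j) t = -j * joeTerm a j t + (a - j) * joeTerm a (j + 1) t := by
  have h : HasDerivAt (fun t : ℝ => Real.exp (-(j * t))) (Real.exp (-(j * t)) * -j) t := by
    simpa using ((hasDerivAt_id t).const_mul (j : ℝ)).neg.exp
  have hexp : Real.exp (-((j + 1 : ℕ) * t)) = Real.exp (-(j * t)) * Real.exp (-t) := by
    rw [← Real.exp_add]
    push_cast
    ring_nf
  have hpow : a - (j + 1 : ℕ) = a - j - 1 := by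
    push_cast
    ring
  refine (h.mul (hasDerivAt_one_sub_exp_neg_rpow (a - j) ht)).deriv.trans ?_
  rw [joeTerm, joeTerm, hexp, hpow]
  ring

theorem iteratedDeriv_succ_joeTerm (a : ℝ) (j n : ℕ) {t : ℝ} (ht : 0 < t) :
    iteratedDeriv (n + 1) (joeTerm a j) t =
      -j * iteratedDeriv n (joeTerm a j) t + (a - j) * iteratedDeriv n (joeTerm a (j + 1)) t := by
  have h : deriv (joeTerm a j) =ᶠ[nhds t]
      fun s => -j * joeTerm a j s + (a - j) * joeTerm a (j + 1) s := by
    filter_upwards [Ioi_mem_nhds ht] with s hs using deriv_joeTerm a j hs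
  rw [iteratedDeriv_succ', h.iteratedDeriv_eq, iteratedDeriv_fun_add
    (contDiffAt_const.mul (contDiffAt_joeTerm a j ht))
    (contDiffAt_const.mul (contDiffAt_joeTerm a (j + 1) ht)),
    iteratedDeriv_const_mul_field, iteratedDeriv_const_mul_field]

theorem neg_one_pow_mul_iteratedDeriv_joeTerm_nonneg {a : ℝ} (ha : a ≤ 1) (n : ℕ) {j : ℕ}
    (hj : 1 ≤ j) {t : ℝ} (ht : 0 < t) : 0 ≤ (-1 : ℝ) ^ n * iteratedDeriv n (joeTerm a j) t := by
  induction n generalizing j with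
  | zero => simpa using joeTerm_nonneg a j ht
  | succ n ih =>
    have hja : 0 ≤ j - a := sub_nonneg.2 (ha.trans (by exact_mod_cast hj))
    have h₁ := mul_nonneg (Nat.cast_nonneg (α := ℝ) j) (ih hj)
    have h₂ := mul_nonneg hja (ih (j := j + 1) (by lia))
    rw [iteratedDeriv_succ_joeTerm a j n ht, pow_succ]
    linarith

theorem deriv_one_sub_one_sub_exp_neg_rpow (a : ℝ) {t : ℝ} (ht : 0 < t) :
    deriv (fun t => 1 - (1 - Real.exp (-t)) ^ a) t = -a * joeTerm a 1 t := by
  rw [((hasDerivAt_one_sub_exp_neg_rpow a ht).const_sub 1).deriv, joeTerm]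
  simp

/-- The generator of the bivariate Joe copula, `ψ_θ(t) = 1 - (1 - exp (-t))^(1/θ)`,
is completely monotone on `(0,∞)` for `θ ≥ 1`. -/
theorem joe_generator_completelyMonotone (θ : ℝ) (hθ : 1 ≤ θ) :
    CompletelyMonotoneOn (fun t => 1 - (1 - Real.exp (-t)) ^ (1 / θ)) := by
  have ha₀ : 0 ≤ 1 / θ := by positivity
  have ha₁ : 1 / θ ≤ 1 := div_le_one_of_le₀ hθ (by positivity)
  generalize 1 / θ = a at ha₀ ha₁
  refine ⟨fun t ht => (contDiffAt_const.sub
    (contDiffAt_one_sub_exp_neg_rpow a ht)).contDiffWithinAt, fun n t ht => ?_⟩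
  cases n with
  | zero =>
    simpa using Real.rpow_le_one (one_sub_exp_neg_pos ht).le
      (sub_le_self 1 (Real.exp_pos _).le) ha₀
  | succ n =>
    have h : deriv (fun t => 1 - (1 - Real.exp (-t)) ^ a) =ᶠ[nhds t]
        fun s => -a * joeTerm a 1 s := by
      filter_upwards [Ioi_mem_nhds ht] with s hs using deriv_one_sub_one_sub_exp_neg_rpow a hs
    rw [iteratedDeriv_succ', h.iteratedDeriv_eq, iteratedDeriv_const_mul_field, pow_succ]
    have := mul_nonneg ha₀ (neg_one_pow_mul_iteratedDeriv_joeTerm_nonneg ha₁ n le_rfl ht)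
    linarith
end

section
/- For every θ ≥ 1, the generator of Nelsen's Archimedean copula family 4.14, ψ_θ(t) = (t^{1/θ} + 1)^{-θ}, is completely monotone on (0,∞). -/
theorem contDiffAt_rpow_mul_rpow (a p q : ℝ) {n : WithTop ℕ∞} {t : ℝ} (ht : 0 < t) :
    ContDiffAt ℝ n (fun x : ℝ => x ^ p * (x ^ a + 1) ^ q) t :=
  (Real.contDiffAt_rpow_const_of_ne ht.ne').mul
    (((Real.contDiffAt_rpow_const_of_ne ht.ne').add contDiffAt_const).rpow_const_of_ne
      (by positivity))

open Topology in
/-- The cone spanned by the functions `t ^ p * (t ^ a + 1) ^ (-q)` with `p ≤ 0 ≤ q` is stable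
under `-d/dt` when `0 ≤ a ≤ 1`, so each of its elements has alternating derivatives. -/
theorem alternating_iteratedDeriv_rpow_mul_rpow {a : ℝ} (ha₀ : 0 ≤ a) (ha₁ : a ≤ 1) (n : ℕ)
    {p q : ℝ} (hp : p ≤ 0) (hq : 0 ≤ q) {t : ℝ} (ht : 0 < t) :
    0 ≤ (-1 : ℝ) ^ n * iteratedDeriv n (fun x => x ^ p * (x ^ a + 1) ^ (-q)) t := by
  induction n generalizing p q with
  | zero =>
    simp only [pow_zero, iteratedDeriv_zero, one_mul]
    positivity
  | succ n ih =>
    have hderiv : deriv (fun x : ℝ => x ^ p * (x ^ a + 1) ^ (-q)) =ᶠ[𝓝 t]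
        fun x => p * (x ^ (p - 1) * (x ^ a + 1) ^ (-q)) +
          (-(q * a)) * (x ^ (p + (a - 1)) * (x ^ a + 1) ^ (-(q + 1))) := by
      filter_upwards [Ioi_mem_nhds ht] with x hx
      have hx : 0 < x := hx
      have hpow : 0 < x ^ a + 1 := by positivity
      have h := (Real.hasDerivAt_rpow_const (p := p) (Or.inl hx.ne')).mul
        (((Real.hasDerivAt_rpow_const (p := a) (Or.inl hx.ne')).add_const 1).rpow_const
          (p := -q) (Or.inl hpow.ne'))
      refine h.deriv.trans ?_
      rw [Real.rpow_add hx, neg_add']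
      ring
    rw [iteratedDeriv_succ', hderiv.iteratedDeriv_eq,
      iteratedDeriv_fun_add
        (contDiffAt_const.mul (contDiffAt_rpow_mul_rpow _ _ _ ht))
        (contDiffAt_const.mul (contDiffAt_rpow_mul_rpow _ _ _ ht)),
      iteratedDeriv_const_mul_field, iteratedDeriv_const_mul_field]
    have h₁ := mul_nonneg (neg_nonneg.2 hp) (ih (p := p - 1) (by linarith) hq)
    have h₂ := mul_nonneg (mul_nonneg hq ha₀)
      (ih (p := p + (a - 1)) (q := q + 1) (by linarith) (by linarith))
    rw [pow_succ]
    linarith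

/-- The generator of Nelsen's Archimedean copula family 4.14,
`ψ_θ(t) = (t^(1/θ) + 1)^(-θ)`, is completely monotone on `(0,∞)` for `θ ≥ 1`. -/
theorem nelsen414_generator_completelyMonotone (θ : ℝ) (hθ : 1 ≤ θ) :
    CompletelyMonotoneOn (fun t => (t ^ (1 / θ) + 1) ^ (-θ)) := by
  have hθ₀ : 0 < θ := by linarith
  have hf : (fun t : ℝ => (t ^ (1 / θ) + 1) ^ (-θ)) =
      fun t => t ^ (0 : ℝ) * (t ^ (1 / θ) + 1) ^ (-θ) := by
    simp
  rw [hf]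
  exact ⟨fun t ht => (contDiffAt_rpow_mul_rpow _ _ _ ht).contDiffWithinAt, fun n t ht =>
    alternating_iteratedDeriv_rpow_mul_rpow (by positivity) ((div_le_one hθ₀).2 hθ) n
      le_rfl hθ₀.le ht⟩
end

section
/- For every θ > 0, the generator of Nelsen's Archimedean copula family 4.19, ψ_θ(t) = θ / log(t + exp(θ)), is completely monotone on (0,∞). -/
open Polynomial in
/-- With `y = (log x)⁻¹`, the `n`-th derivative of `(log x)⁻¹` is `(-1)ⁿ x⁻ⁿ p(y)` for a polynomial
`p` with natural number coefficients. -/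
theorem exists_iteratedDeriv_div_log_add_eq (θ a : ℝ) (ha : 1 ≤ a) (n : ℕ) :
    ∃ p : ℕ[X], ∀ t : ℝ, 0 < t → iteratedDeriv n (fun t => θ / Real.log (t + a)) t =
      (-1) ^ n * (θ * ((t + a)⁻¹ ^ n *
        (p.map (Nat.castRingHom ℝ)).eval (Real.log (t + a))⁻¹)) := by
  induction n with
  | zero => exact ⟨X, fun t _ => by simp [div_eq_mul_inv]⟩
  | succ n ih =>
    obtain ⟨p, hp⟩ := ih
    refine ⟨(n : ℕ[X]) * p + X ^ 2 * derivative p, fun t ht => ?_⟩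
    have hx : t + a ≠ 0 := by linarith
    have hL : Real.log (t + a) ≠ 0 := (Real.log_pos (by linarith)).ne'
    have hadd : HasDerivAt (fun s : ℝ => s + a) 1 t := (hasDerivAt_id t).add_const a
    have hlog := (hadd.log hx).fun_inv hL
    have hpoly := ((p.map (Nat.castRingHom ℝ)).hasDerivAt _).comp t hlog
    have hderiv := (((((hadd.fun_inv hx).fun_pow n).mul hpoly).const_mul θ).const_mul ((-1) ^ n))
    rw [iteratedDeriv_succ, Filter.EventuallyEq.deriv_eq
      (Filter.eventually_of_mem (Ioi_mem_nhds ht) hp)]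
    refine hderiv.deriv.trans ?_
    simp only [Function.comp_apply, Polynomial.map_add, Polynomial.map_mul, Polynomial.map_pow,
      Polynomial.map_natCast, map_X, eval_add, eval_mul, eval_pow, eval_natCast, eval_X,
      derivative_map]
    cases n with
    | zero => simp; ring
    | succ m =>
      simp only [Nat.add_sub_cancel, div_eq_mul_inv, ← inv_pow]
      ring

/-- The generator of Nelsen's Archimedean copula family 4.19,
`ψ_θ(t) = θ / log (t + exp θ)`, is completely monotone on `(0,∞)` for `θ > 0`. -/
theorem nelsen419_generator_completelyMonotone (θ : ℝ) (hθ : 0 < θ) :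
    CompletelyMonotoneOn (fun t => θ / Real.log (t + Real.exp θ)) := by
  have ha : 1 ≤ Real.exp θ := Real.one_le_exp hθ.le
  refine ⟨fun t ht => ContDiffAt.contDiffWithinAt ?_, fun n t ht => ?_⟩
  · have ht : 0 < t := ht
    exact contDiffAt_const.div ((contDiffAt_id.add contDiffAt_const).log
      (by simp only [id]; linarith)) (Real.log_pos (by linarith)).ne'
  · obtain ⟨p, hp⟩ := exists_iteratedDeriv_div_log_add_eq θ _ ha n
    have hL : 0 < Real.log (t + Real.exp θ) := Real.log_pos (by linarith)
    rw [hp t ht, ← mul_assoc, ← mul_pow, neg_one_mul, neg_neg, one_pow, one_mul,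
      Polynomial.eval_map, Polynomial.eval₂_eq_sum_range]
    have hsum : 0 ≤ ∑ i ∈ Finset.range (p.natDegree + 1),
        Nat.castRingHom ℝ (p.coeff i) * (Real.log (t + Real.exp θ))⁻¹ ^ i :=
      Finset.sum_nonneg fun i _ => mul_nonneg (Nat.cast_nonneg _) (by positivity)
    positivity
end

section
/- For every θ > 0 and every δ ≥ 1, the generator of the two-parameter bivariate BB1 copula, η_{θ,δ}(s) = (1 + s^{1/δ})^{-1/θ}, is completely monotone on (0,∞). -/
theorem contDiffAt_rpow_mul_one_add_rpow (a b q t : ℝ) (ht : 0 < t) (n : WithTop ℕ∞) :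
    ContDiffAt ℝ n (fun s : ℝ => s ^ (-b) * (1 + s ^ a) ^ (-q)) t := by
  have h1 : 1 + t ^ a ≠ 0 := by positivity
  exact (contDiffAt_id.rpow_const_of_ne ht.ne').mul
    ((contDiffAt_const.add (contDiffAt_id.rpow_const_of_ne ht.ne')).rpow_const_of_ne h1)

theorem deriv_rpow_mul_one_add_rpow (a b q t : ℝ) (ht : 0 < t) :
    deriv (fun s : ℝ => s ^ (-b) * (1 + s ^ a) ^ (-q)) t =
      (-b) * (t ^ (-(b + 1)) * (1 + t ^ a) ^ (-q)) +
      (-(q * a)) * (t ^ (-(b + 1 - a)) * (1 + t ^ a) ^ (-(q + 1))) := by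
  have h1 : 1 + t ^ a ≠ 0 := by positivity
  have hd := ((hasDerivAt_id t).rpow_const (p := -b) (Or.inl ht.ne')).mul
    ((((hasDerivAt_id t).rpow_const (p := a) (Or.inl ht.ne')).const_add 1).rpow_const
      (p := -q) (Or.inl h1))
  refine hd.deriv.trans ?_
  have hb : t ^ (-(b + 1 - a)) = t ^ (-b) * t ^ (a - 1) := by
    rw [← Real.rpow_add ht]; ring_nf
  simp only [id, hb, neg_add']
  ring

/-- The functions `s ^ (-b) * (1 + s ^ a) ^ (-q)` with `a ∈ [0, 1]` and `b, q ≥ 0` are closed,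
up to nonnegative combinations, under `-d/ds`. -/
theorem iteratedDeriv_rpow_mul_one_add_rpow_sign {a : ℝ} (ha : 0 ≤ a) (ha1 : a ≤ 1) (n : ℕ) :
    ∀ b q t : ℝ, 0 ≤ b → 0 ≤ q → 0 < t →
      0 ≤ (-1 : ℝ) ^ n * iteratedDeriv n (fun s : ℝ => s ^ (-b) * (1 + s ^ a) ^ (-q)) t := by
  induction n with
  | zero =>
    intro b q t _ _ ht
    simp only [pow_zero, iteratedDeriv_zero, one_mul]
    positivity
  | succ n ih =>
    intro b q t hb hq ht
    have hev : deriv (fun s : ℝ => s ^ (-b) * (1 + s ^ a) ^ (-q)) =ᶠ[nhds t]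
        fun s => (-b) * (s ^ (-(b + 1)) * (1 + s ^ a) ^ (-q)) +
          (-(q * a)) * (s ^ (-(b + 1 - a)) * (1 + s ^ a) ^ (-(q + 1))) := by
      filter_upwards [Ioi_mem_nhds ht] with s hs
      exact deriv_rpow_mul_one_add_rpow a b q s hs
    have h1 := contDiffAt_rpow_mul_one_add_rpow a (b + 1) q t ht n
    have h2 := contDiffAt_rpow_mul_one_add_rpow a (b + 1 - a) (q + 1) t ht n
    rw [iteratedDeriv_succ', hev.iteratedDeriv_eq,
      iteratedDeriv_fun_add (contDiffAt_const.mul h1) (contDiffAt_const.mul h2),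
      iteratedDeriv_const_mul _ h1, iteratedDeriv_const_mul _ h2]
    have i1 := mul_nonneg hb (ih (b + 1) q t (by linarith) hq ht)
    have i2 := mul_nonneg (mul_nonneg hq ha)
      (ih (b + 1 - a) (q + 1) t (by linarith) (by linarith) ht)
    rw [pow_succ]
    linarith

/-- The generator of the two-parameter bivariate BB1 copula,
`η_{θ,δ}(s) = (1 + s^(1/δ))^(-1/θ)`, is completely monotone on `(0,∞)` for
`θ > 0` and `δ ≥ 1`. -/
theorem bb1_generator_completelyMonotone (θ δ : ℝ) (hθ : 0 < θ) (hδ : 1 ≤ δ) :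
    CompletelyMonotoneOn (fun s => (1 + s ^ (1 / δ)) ^ (-(1 / θ))) := by
  have hδ0 : 0 < δ := by linarith
  have hf : (fun s : ℝ => (1 + s ^ (1 / δ)) ^ (-(1 / θ))) =
      fun s => s ^ (-(0 : ℝ)) * (1 + s ^ (1 / δ)) ^ (-(1 / θ)) := by
    funext s
    simp
  rw [hf]
  refine ⟨fun t ht => (contDiffAt_rpow_mul_one_add_rpow _ _ _ t ht _).contDiffWithinAt,
    fun n t ht => ?_⟩
  exact iteratedDeriv_rpow_mul_one_add_rpow_sign (by positivity)
    ((div_le_one hδ0).2 hδ) n 0 (1 / θ) t le_rfl (by positivity) ht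
end
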